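/- If S ≥ L+2, then, setting 1−τ = −log(Sγ)/log γ (which is a number in (0,1)), there exist constants c, c' > 0 such that for every n ≥ 1, c' · t_n^{1−τ} ≤ t_n · D(Λ^n_{L,S}) ≤ c · t_n^{1−τ}, where Λ^n_{L,S} is the set of the t_n left endpoints of the n-th LS-partition. -/

import Mathlib

/-- The coefficient `b(i)`: `b(i) = i` if `i ≤ L−1` and `b(i) = L + (i−L)γ` if `i ≥ L`. -/
noncomputable def bcoef (L : ℕ) (γ : ℝ) (i : ℕ) : ℝ :=
  if i < L then (i : ℝ) else (L : ℝ) + ((i : ℝ) - (L : ℝ)) * γ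

/-- The set `Λⁿ_{L,S}` of left endpoints `Σ_{k=1}^n b(i_k)γᵏ` of the `n`-th LS-partition,
indexed by the admissible `n`-tuples of digits. -/
noncomputable def lamSet (L S : ℕ) (γ : ℝ) (n : ℕ) : Set ℝ :=
  {x : ℝ | ∃ i : Fin n → Fin (L + S),
    (∀ h h' : Fin n, (h' : ℕ) = (h : ℕ) + 1 → ¬(L ≤ (i h : ℕ) ∧ 1 ≤ (i h' : ℕ))) ∧
    x = ∑ k : Fin n, bcoef L γ (i k : ℕ) * γ ^ ((k : ℕ) + 1)}

/-- The discrepancy of a finite set `Q ⊂ [0,1)` of `t` points: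
`D(Q) = sup_{0 ≤ a < b ≤ 1} | (1/t)·#{y ∈ Q : y ∈ [a,b)} − (b−a) |`. -/
noncomputable def discSet (Q : Set ℝ) : ℝ :=
  sSup {d : ℝ | ∃ a b : ℝ, 0 ≤ a ∧ a < b ∧ b ≤ 1 ∧
    d = |((Q ∩ Set.Ico a b).ncard : ℝ) / (Q.ncard : ℝ) - (b - a)|}

/-- Points of `Q` strictly below `x`. -/
noncomputable def countBelow (Q : Set ℝ) (x : ℝ) : ℕ := (Q ∩ Set.Iio x).ncard

/-- The union of the affine copies `P j + r j • W j`, `j < m`. -/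
def affineUnion (m : ℕ) (P r : ℕ → ℝ) (W : ℕ → Set ℝ) : Set ℝ :=
  {x | ∃ j < m, ∃ y ∈ W j, x = P j + r j * y}

section AffineUnion

variable {m : ℕ} {P r : ℕ → ℝ} {W : ℕ → Set ℝ}

theorem affineUnion_finite (hW : ∀ j < m, (W j).Finite) : (affineUnion m P r W).Finite := by
  have h : affineUnion m P r W = ⋃ j ∈ Set.Iio m, (fun y => P j + r j * y) '' W j := by
    ext x
    simp only [affineUnion, Set.mem_ofPred_eq, Set.mem_iUnion, Set.mem_image, Set.mem_Iio,
      exists_prop]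
    exact exists_congr fun j => and_congr_right fun _ => exists_congr fun y =>
      and_congr_right fun _ => eq_comm
  rw [h]
  exact (Set.finite_Iio m).biUnion fun j hj => (hW j hj).image _

theorem monotone_of_step (hr : ∀ j, 0 < r j) (hP : ∀ j, P (j + 1) = P j + r j) : Monotone P :=
  monotone_nat_of_le_succ fun j => by rw [hP]; linarith [hr j]

theorem affineUnion_subset_Ico (hr : ∀ j, 0 < r j) (hP : ∀ j, P (j + 1) = P j + r j)
    (hW : ∀ j < m, W j ⊆ Set.Ico 0 1) : affineUnion m P r W ⊆ Set.Ico (P 0) (P m) := by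
  rintro x ⟨j, hj, y, hy, rfl⟩
  obtain ⟨h0, h1⟩ := hW j hj hy
  have hmono := monotone_of_step hr hP
  have hm := hmono (Nat.succ_le_of_lt hj)
  have hz := hmono (Nat.zero_le j)
  rw [Nat.succ_eq_add_one, hP] at hm
  have := hr j
  constructor <;> nlinarith

theorem countBelow_affineUnion (hr : ∀ j, 0 < r j) (hP : ∀ j, P (j + 1) = P j + r j)
    (hW : ∀ j < m, W j ⊆ Set.Ico 0 1) (hfin : ∀ j < m, (W j).Finite) {j : ℕ} (hj : j < m)
    {y : ℝ} (hy0 : 0 ≤ y) (hy1 : y ≤ 1) :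
    countBelow (affineUnion m P r W) (P j + r j * y) =
      countBelow (affineUnion m P r W) (P j) + countBelow (W j) y := by
  have hmono := monotone_of_step hr hP
  have hrj := hr j
  have hsplit : affineUnion m P r W ∩ Set.Iio (P j + r j * y) =
      (affineUnion m P r W ∩ Set.Iio (P j)) ∪
        (fun z => P j + r j * z) '' (W j ∩ Set.Iio y) := by
    ext x
    constructor
    · rintro ⟨⟨i, hi, z, hz, rfl⟩, hx⟩
      obtain ⟨hz0, hz1⟩ := hW i hi hz
      have hri := hr i
      simp only [Set.mem_Iio] at hx
      rcases lt_trichotomy i j with h | rfl | h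
      · refine Or.inl ⟨⟨i, hi, z, hz, rfl⟩, ?_⟩
        have := hmono (Nat.succ_le_of_lt h)
        rw [Nat.succ_eq_add_one, hP] at this
        simp only [Set.mem_Iio]
        nlinarith
      · exact Or.inr ⟨z, ⟨hz, lt_of_mul_lt_mul_left (by linarith) hri.le⟩, rfl⟩
      · have := hmono (Nat.succ_le_of_lt h)
        rw [Nat.succ_eq_add_one, hP] at this
        nlinarith
    · rintro (⟨hx, hlt⟩ | ⟨z, ⟨hz, hlt⟩, rfl⟩)
      · exact ⟨hx, lt_add_of_lt_of_nonneg hlt (mul_nonneg hrj.le hy0)⟩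
      · refine ⟨⟨j, hj, z, hz, rfl⟩, ?_⟩
        simp only [Set.mem_Iio] at hlt ⊢
        nlinarith
  have hdisj : Disjoint (affineUnion m P r W ∩ Set.Iio (P j))
      ((fun z => P j + r j * z) '' (W j ∩ Set.Iio y)) := by
    rw [Set.disjoint_left]
    rintro x ⟨_, hlt⟩ ⟨z, ⟨hz, _⟩, rfl⟩
    have := (hW j hj hz).1
    simp only [Set.mem_Iio] at hlt
    nlinarith
  have hinj : Function.Injective fun z : ℝ => P j + r j * z := fun a b hab =>
    mul_left_cancel₀ hrj.ne' (add_left_cancel hab)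
  rw [countBelow, hsplit, Set.ncard_union_eq hdisj
    ((affineUnion_finite hfin).inter_of_left _)
    (((hfin j hj).inter_of_left _).image _), Set.ncard_image_of_injective _ hinj]
  rfl

theorem exists_piece (hP : ∀ j, P (j + 1) = P j + r j) {x : ℝ} (hx : P 0 ≤ x) :
    ∀ m : ℕ, 0 < m → x ≤ P m → ∃ j < m, P j ≤ x ∧ x ≤ P j + r j := by
  intro m
  induction m with
  | zero => intro h; exact absurd h (lt_irrefl _)
  | succ k ih =>
    intro _ hxm
    by_cases hk : P k ≤ x
    · exact ⟨k, k.lt_succ_self, hk, hP k ▸ hxm⟩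
    · have hk0 : 0 < k := Nat.pos_of_ne_zero fun h => hk (h ▸ hx)
      obtain ⟨j, hj, h⟩ := ih hk0 (not_le.mp hk).le
      exact ⟨j, hj.trans k.lt_succ_self, h⟩

end AffineUnion

theorem countBelow_of_subset {Q : Set ℝ} {x : ℝ} (h : ∀ y ∈ Q, y < x) :
    countBelow Q x = Q.ncard := by
  rw [countBelow, Set.inter_eq_left.mpr (show Q ⊆ Set.Iio x from h)]

theorem countBelow_eq_zero {Q : Set ℝ} {x : ℝ} (h : ∀ y ∈ Q, x ≤ y) : countBelow Q x = 0 := by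
  have : Q ∩ Set.Iio x = ∅ := by
    ext y
    simp only [Set.mem_inter_iff, Set.mem_Iio, Set.mem_empty_iff_false, iff_false, not_and, not_lt]
    exact h y
  rw [countBelow, this, Set.ncard_empty]

theorem ncard_inter_Ico {Q : Set ℝ} (hQ : Q.Finite) {a b : ℝ} (hab : a ≤ b) :
    ((Q ∩ Set.Ico a b).ncard : ℝ) = countBelow Q b - countBelow Q a := by
  have hsplit : Q ∩ Set.Iio b = (Q ∩ Set.Iio a) ∪ (Q ∩ Set.Ico a b) := by
    rw [← Set.inter_union_distrib_left, Set.Iio_union_Ico_eq_Iio hab]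
  have hdisj : Disjoint (Q ∩ Set.Iio a) (Q ∩ Set.Ico a b) := by
    rw [Set.disjoint_left]
    rintro x ⟨_, h⟩ ⟨_, h', _⟩
    exact absurd h (not_lt.mpr h')
  simp only [countBelow]
  rw [hsplit, Set.ncard_union_eq hdisj (hQ.inter_of_left _) (hQ.inter_of_left _)]
  push_cast
  ring

/-- The signed local discrepancy `#(Q ∩ (-∞, x)) - #Q · x`. -/
noncomputable def localDisc (Q : Set ℝ) (x : ℝ) : ℝ := countBelow Q x - Q.ncard * x

theorem abs_ncard_div_sub {Q : Set ℝ} (hQ : Q.Finite) (hne : Q.Nonempty) {a b : ℝ}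
    (hab : a ≤ b) :
    |((Q ∩ Set.Ico a b).ncard : ℝ) / (Q.ncard : ℝ) - (b - a)| =
      |localDisc Q b - localDisc Q a| / Q.ncard := by
  have hpos : (0 : ℝ) < Q.ncard := by exact_mod_cast (Set.ncard_pos hQ).mpr hne
  rw [ncard_inter_Ico hQ hab, ← abs_of_pos hpos, ← abs_div, abs_of_pos hpos]
  congr 1
  simp only [localDisc]
  field_simp
  ring

theorem ncard_mul_discSet_le {Q : Set ℝ} (hQ : Q.Finite) (hne : Q.Nonempty) {M : ℝ}
    (hM : ∀ x, 0 ≤ x → x ≤ 1 → |localDisc Q x| ≤ M) :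
    (Q.ncard : ℝ) * discSet Q ≤ 2 * M := by
  have hpos : (0 : ℝ) < Q.ncard := by exact_mod_cast (Set.ncard_pos hQ).mpr hne
  rw [mul_comm, ← le_div_iff₀ hpos]
  refine csSup_le ⟨_, 0, 1, le_rfl, one_pos, le_rfl, rfl⟩ ?_
  rintro d ⟨a, b, ha, hab, hb, rfl⟩
  rw [abs_ncard_div_sub hQ hne hab.le]
  gcongr
  calc |localDisc Q b - localDisc Q a| ≤ |localDisc Q b| + |localDisc Q a| := abs_sub _ _
    _ ≤ 2 * M := by linarith [hM a ha (hab.le.trans hb), hM b (ha.trans hab.le) hb]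

theorem le_ncard_mul_discSet {Q : Set ℝ} (hQ : Q.Finite) (hne : Q.Nonempty) {M : ℝ}
    (hM : ∀ x, 0 ≤ x → x ≤ 1 → |localDisc Q x| ≤ M) {a b : ℝ} (ha : 0 ≤ a) (hab : a < b)
    (hb : b ≤ 1) : |localDisc Q b - localDisc Q a| ≤ (Q.ncard : ℝ) * discSet Q := by
  have hpos : (0 : ℝ) < Q.ncard := by exact_mod_cast (Set.ncard_pos hQ).mpr hne
  rw [mul_comm, ← div_le_iff₀ hpos]
  refine le_csSup ⟨2 * M / Q.ncard, ?_⟩ ⟨a, b, ha, hab, hb, (abs_ncard_div_sub hQ hne hab.le).symm⟩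
  rintro d ⟨a', b', ha', hab', hb', rfl⟩
  rw [abs_ncard_div_sub hQ hne hab'.le]
  gcongr
  calc |localDisc Q b' - localDisc Q a'| ≤ |localDisc Q b'| + |localDisc Q a'| := abs_sub _ _
    _ ≤ 2 * M := by linarith [hM a' ha' (hab'.le.trans hb'), hM b' (ha'.trans hab'.le) hb']

/-- Local discrepancies of an affine union in terms of those of its pieces. -/
theorem abs_localDisc_affineUnion_le {m : ℕ} {P r : ℕ → ℝ} {W : ℕ → Set ℝ} (hm : 0 < m)
    (hr : ∀ j, 0 < r j) (hP : ∀ j, P (j + 1) = P j + r j) (hP0 : P 0 = 0) (hPm : P m = 1)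
    (hW : ∀ j < m, W j ⊆ Set.Ico 0 1) (hfin : ∀ j < m, (W j).Finite) {M ε : ℝ} (hε : 0 ≤ ε)
    (hM : ∀ j < m, ∀ x, 0 ≤ x → x ≤ 1 → |localDisc (W j) x| ≤ M)
    (hdev : ∀ j < m, |((W j).ncard : ℝ) - r j * (affineUnion m P r W).ncard| ≤ ε)
    {x : ℝ} (hx0 : 0 ≤ x) (hx1 : x ≤ 1) :
    |localDisc (affineUnion m P r W) x| ≤ M + m * ε := by
  set U := affineUnion m P r W with hU
  have hsub := affineUnion_subset_Ico hr hP hW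
  have step : ∀ j < m, ∀ y, 0 ≤ y → y ≤ 1 → localDisc U (P j + r j * y) =
      localDisc U (P j) + localDisc (W j) y + y * ((W j).ncard - r j * U.ncard) := by
    intro j hj y hy0 hy1
    simp only [localDisc, hU]
    rw [countBelow_affineUnion hr hP hW hfin hj hy0 hy1]
    push_cast
    ring
  have node : ∀ j ≤ m, |localDisc U (P j)| ≤ j * ε := by
    intro j
    induction j with
    | zero =>
      intro _
      have : countBelow U (P 0) = 0 := countBelow_eq_zero fun y hy => (hsub hy).1
      rw [localDisc, this, hP0]
      simp
    | succ k ih =>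
      intro hk
      have hkm : k < m := hk
      have h := step k hkm 1 zero_le_one le_rfl
      have h1 : localDisc (W k) 1 = 0 := by
        rw [localDisc, countBelow_of_subset fun y hy => (hW k hkm hy).2]
        ring
      rw [hP, ← mul_one (r k), h, h1, add_zero, one_mul]
      push_cast
      calc _ ≤ _ := abs_add_le _ _
        _ ≤ (k + 1) * ε := by linarith [ih hkm.le, hdev k hkm]
  obtain ⟨j, hj, hjx, hxj⟩ := exists_piece hP (hP0 ▸ hx0) m hm (hPm ▸ hx1)
  have hrj := hr j
  obtain ⟨y, hy⟩ : ∃ y, y = (x - P j) / r j := ⟨_, rfl⟩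
  have hxy : x = P j + r j * y := by rw [hy]; field_simp; ring
  have hy0 : 0 ≤ y := by rw [hy]; exact div_nonneg (by linarith) hrj.le
  have hy1 : y ≤ 1 := by rw [hy, div_le_one hrj]; linarith
  rw [hxy, step j hj y hy0 hy1]
  have h1 : |y * ((W j).ncard - r j * U.ncard)| ≤ ε := by
    rw [abs_mul, abs_of_nonneg hy0]
    calc _ ≤ 1 * _ := mul_le_mul_of_nonneg_right hy1 (abs_nonneg _)
      _ ≤ ε := by rw [one_mul]; exact hdev j hj
  have h2 : ((j : ℝ) + 1) * ε ≤ m * ε := by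
    gcongr
    exact_mod_cast hj
  calc _ ≤ |localDisc U (P j)| + |localDisc (W j) y| + _ := abs_add_three _ _ _
    _ ≤ M + m * ε := by linarith [node j hj.le, hM j hj y hy0 hy1]

section LSPartition

variable {L S : ℕ} {γ : ℝ}

/-- Length of the `i`-th interval of the first LS-partition. -/
noncomputable def pieceLength (L : ℕ) (γ : ℝ) (i : ℕ) : ℝ := if i < L then γ else γ ^ 2

theorem pieceLength_pos (hγ : 0 < γ) (i : ℕ) : 0 < pieceLength L γ i := by
  unfold pieceLength
  split_ifs <;> positivity

theorem bcoef_succ_mul (i : ℕ) :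
    bcoef L γ (i + 1) * γ = bcoef L γ i * γ + pieceLength L γ i := by
  unfold bcoef pieceLength
  rcases lt_trichotomy (i + 1) L with h | rfl | h
  · rw [if_pos h, if_pos (by omega), if_pos (by omega)]
    push_cast
    ring
  · simp
    ring
  · rw [if_neg (by omega), if_neg (by omega), if_neg (by omega)]
    push_cast
    ring

theorem bcoef_zero (hL : 1 ≤ L) : bcoef L γ 0 = 0 := by
  simp [bcoef, show 0 < L by omega]

theorem bcoef_total : bcoef L γ (L + S) * γ = L * γ + S * γ ^ 2 := by
  simp [bcoef]
  ring

/-- Left endpoints of the LS-partitions, with the index shifted by one: `lsPoints (n + 1)` is the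
`n`-th LS-point set, described through its self-similarity. -/
noncomputable def lsPoints (L S : ℕ) (γ : ℝ) : ℕ → Set ℝ
  | 0 => {0}
  | 1 => {0}
  | n + 2 => affineUnion (L + S) (fun i => bcoef L γ i * γ) (pieceLength L γ)
      (fun i => if i < L then lsPoints L S γ (n + 1) else lsPoints L S γ n)

/-- Infinite admissible digit sequences. -/
def IsAdmissible (L S : ℕ) (a : ℕ → ℕ) : Prop :=
  (∀ k, a k < L + S) ∧ ∀ k, ¬(L ≤ a k ∧ 1 ≤ a (k + 1))

theorem IsAdmissible.tail {a : ℕ → ℕ} (h : IsAdmissible L S a) :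
    IsAdmissible L S fun k => a (k + 1) :=
  ⟨fun _ => h.1 _, fun _ => h.2 _⟩

/-- Prepend a digit to a sequence. -/
def consDigit (j : ℕ) (a : ℕ → ℕ) : ℕ → ℕ
  | 0 => j
  | k + 1 => a k

theorem IsAdmissible.cons {a : ℕ → ℕ} (h : IsAdmissible L S a) {j : ℕ} (hj : j < L + S)
    (hja : ¬(L ≤ j ∧ 1 ≤ a 0)) : IsAdmissible L S (consDigit j a) := by
  refine ⟨fun k => ?_, fun k => ?_⟩
  · cases k with
    | zero => exact hj
    | succ k => exact h.1 k
  · cases k with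
    | zero => exact hja
    | succ k => exact h.2 k

/-- The value of the first `n` digits of a sequence. -/
noncomputable def digitSum (L : ℕ) (γ : ℝ) (n : ℕ) (a : ℕ → ℕ) : ℝ :=
  ∑ k ∈ Finset.range n, bcoef L γ (a k) * γ ^ (k + 1)

theorem digitSum_succ (n : ℕ) (a : ℕ → ℕ) :
    digitSum L γ (n + 1) a =
      bcoef L γ (a 0) * γ + γ * digitSum L γ n fun k => a (k + 1) := by
  rw [digitSum, Finset.sum_range_succ', digitSum, Finset.mul_sum, zero_add, pow_one, add_comm]
  congr 1
  exact Finset.sum_congr rfl fun k _ => by ring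

theorem mem_lamSet_iff (hL : 1 ≤ L) {n : ℕ} {x : ℝ} :
    x ∈ lamSet L S γ n ↔ ∃ a, IsAdmissible L S a ∧ x = digitSum L γ n a := by
  constructor
  · rintro ⟨i, hi, rfl⟩
    refine ⟨fun k => if h : k < n then (i ⟨k, h⟩ : ℕ) else 0, ⟨fun k => ?_, fun k => ?_⟩, ?_⟩
    · dsimp only
      split_ifs with h
      · exact (i _).2
      · omega
    · dsimp only
      split_ifs with h h' h'
      · exact hi ⟨k, h⟩ ⟨k + 1, h'⟩ rfl
      all_goals omega
    · rw [digitSum, Finset.sum_range]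
      exact Finset.sum_congr rfl fun k _ => by simp
  · rintro ⟨a, ⟨hlt, hadm⟩, rfl⟩
    refine ⟨fun k => ⟨a k, hlt k⟩, fun h h' hh => ?_, ?_⟩
    · simpa only [hh] using hadm h
    · rw [digitSum, Finset.sum_range]

theorem isAdmissible_zero (hL : 1 ≤ L) : IsAdmissible L S fun _ => 0 :=
  ⟨fun _ => by dsimp only; omega, fun _ => by dsimp only; omega⟩

theorem lamSet_eq_lsPoints (hL : 1 ≤ L) (n : ℕ) : lamSet L S γ n = lsPoints L S γ (n + 1) := by
  have h0 : lamSet L S γ 0 = {0} := by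
    ext x
    rw [mem_lamSet_iff hL]
    constructor
    · rintro ⟨a, _, rfl⟩
      simp [digitSum]
    · rintro rfl
      exact ⟨_, isAdmissible_zero hL, by simp [digitSum]⟩
  have main : ∀ n, lamSet L S γ n = lsPoints L S γ (n + 1) ∧
      lamSet L S γ (n + 1) = lsPoints L S γ (n + 2) := by
    intro n
    induction n with
    | zero =>
      refine ⟨by rw [h0]; simp [lsPoints], ?_⟩
      ext x
      rw [mem_lamSet_iff hL]
      constructor
      · rintro ⟨a, ha, rfl⟩
        refine ⟨a 0, ha.1 0, 0, by simp [lsPoints], by simp [digitSum]⟩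
      · rintro ⟨j, hj, y, hy, rfl⟩
        have hy : y = 0 := by simpa [lsPoints] using hy
        refine ⟨consDigit j fun _ => 0, (isAdmissible_zero hL).cons hj (by omega), ?_⟩
        simp [digitSum, consDigit, hy]
    | succ n ih =>
      refine ⟨ih.2, ?_⟩
      ext x
      rw [mem_lamSet_iff hL, lsPoints]
      constructor
      · rintro ⟨a, ha, rfl⟩
        by_cases hj : a 0 < L
        · refine ⟨a 0, ha.1 0, digitSum L γ (n + 1) fun k => a (k + 1), ?_, ?_⟩
          · dsimp only
            rw [if_pos hj, ← ih.2, mem_lamSet_iff hL]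
            exact ⟨_, ha.tail, rfl⟩
          · rw [digitSum_succ, pieceLength, if_pos hj]
        · refine ⟨a 0, ha.1 0, digitSum L γ n fun k => a (k + 1 + 1), ?_, ?_⟩
          · dsimp only
            rw [if_neg hj, ← ih.1, mem_lamSet_iff hL]
            exact ⟨_, ha.tail.tail, rfl⟩
          · have ha1 : a (0 + 1) = 0 := by
              have := ha.2 0
              omega
            rw [digitSum_succ, digitSum_succ, pieceLength, if_neg hj, ha1, bcoef_zero hL]
            ring
      · rintro ⟨j, hj, y, hy, rfl⟩
        dsimp only at hy ⊢
        by_cases hjL : j < L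
        · rw [if_pos hjL, ← ih.2, mem_lamSet_iff hL] at hy
          obtain ⟨a, ha, rfl⟩ := hy
          refine ⟨consDigit j a, ha.cons hj (by omega), ?_⟩
          rw [digitSum_succ (n + 1) (consDigit j a), pieceLength, if_pos hjL]
          rfl
        · rw [if_neg hjL, ← ih.1, mem_lamSet_iff hL] at hy
          obtain ⟨a, ha, rfl⟩ := hy
          refine ⟨consDigit j (consDigit 0 a),
            (ha.cons (by omega) (by omega)).cons hj (by simp [consDigit]), ?_⟩
          rw [digitSum_succ, digitSum_succ, pieceLength, if_neg hjL]
          simp only [consDigit, bcoef_zero hL]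
          ring
  exact (main n).1

theorem lsPoints_finite : ∀ n, (lsPoints L S γ n).Finite
  | 0 => by simp [lsPoints]
  | 1 => by simp [lsPoints]
  | n + 2 => by
    rw [lsPoints]
    refine affineUnion_finite fun j _ => ?_
    split_ifs
    · exact lsPoints_finite (n + 1)
    · exact lsPoints_finite n

theorem lsPoints_subset (hL : 1 ≤ L) (hγ : 0 < γ) (hγeq : (L : ℝ) * γ + (S : ℝ) * γ ^ 2 = 1) :
    ∀ n, lsPoints L S γ n ⊆ Set.Ico 0 1
  | 0 => by simp [lsPoints]
  | 1 => by simp [lsPoints]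
  | n + 2 => by
    have h := affineUnion_subset_Ico (m := L + S) (P := fun i => bcoef L γ i * γ)
      (W := fun i => if i < L then lsPoints L S γ (n + 1) else lsPoints L S γ n)
      (pieceLength_pos (L := L) hγ) bcoef_succ_mul (fun j _ => by
        split_ifs
        · exact lsPoints_subset hL hγ hγeq (n + 1)
        · exact lsPoints_subset hL hγ hγeq n)
    rw [lsPoints]
    simpa only [bcoef_zero hL, zero_mul, bcoef_total, hγeq] using h

theorem zero_mem_lsPoints (hL : 1 ≤ L) : ∀ n, (0 : ℝ) ∈ lsPoints L S γ n
  | 0 => by simp [lsPoints]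
  | 1 => by simp [lsPoints]
  | n + 2 => by
    rw [lsPoints]
    refine ⟨0, by omega, 0, ?_, by simp [bcoef_zero hL]⟩
    dsimp only
    rw [if_pos (by omega)]
    exact zero_mem_lsPoints hL (n + 1)

theorem countBelow_lsPoints (hL : 1 ≤ L) (hγ : 0 < γ)
    (hγeq : (L : ℝ) * γ + (S : ℝ) * γ ^ 2 = 1) (n : ℕ) {j : ℕ} (hj : j ≤ L + S) :
    countBelow (lsPoints L S γ (n + 2)) (bcoef L γ j * γ) =
      min j L * (lsPoints L S γ (n + 1)).ncard + (j - L) * (lsPoints L S γ n).ncard := by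
  induction j with
  | zero =>
    rw [bcoef_zero hL, zero_mul, countBelow_eq_zero fun y hy => (lsPoints_subset hL hγ hγeq _ hy).1]
    simp
  | succ k ih =>
    have hW : ∀ j < L + S, (if j < L then lsPoints L S γ (n + 1) else lsPoints L S γ n) ⊆
        Set.Ico 0 1 := fun j _ => by
      split_ifs <;> exact lsPoints_subset hL hγ hγeq _
    have hfin : ∀ j < L + S, (if j < L then lsPoints L S γ (n + 1) else lsPoints L S γ n).Finite :=
      fun j _ => by split_ifs <;> exact lsPoints_finite _
    have h := countBelow_affineUnion (m := L + S) (P := fun i => bcoef L γ i * γ)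
      (W := fun i => if i < L then lsPoints L S γ (n + 1) else lsPoints L S γ n)
      (pieceLength_pos (L := L) hγ) bcoef_succ_mul hW hfin (j := k) hj zero_le_one le_rfl
    rw [← lsPoints, mul_one, ← bcoef_succ_mul, ih (by omega),
      countBelow_of_subset fun y hy => (hW k hj hy).2] at h
    rw [h]
    split_ifs with hk
    · rw [min_eq_left (by omega : k ≤ L), min_eq_left (by omega : k + 1 ≤ L),
        show k - L = 0 by omega, show k + 1 - L = 0 by omega]
      ring
    · rw [min_eq_right (by omega : L ≤ k), min_eq_right (by omega : L ≤ k + 1),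
        show k + 1 - L = k - L + 1 by omega]
      ring

theorem ncard_lsPoints_add_two (hL : 1 ≤ L) (hγ : 0 < γ)
    (hγeq : (L : ℝ) * γ + (S : ℝ) * γ ^ 2 = 1) (n : ℕ) :
    (lsPoints L S γ (n + 2)).ncard =
      L * (lsPoints L S γ (n + 1)).ncard + S * (lsPoints L S γ n).ncard := by
  have h := countBelow_lsPoints hL hγ hγeq n (le_refl (L + S))
  rw [bcoef_total, hγeq,
    countBelow_of_subset fun y hy => (lsPoints_subset hL hγ hγeq _ hy).2] at h
  simpa using h

theorem ncard_sub_mul_ncard (hL : 1 ≤ L) (hγ : 0 < γ)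
    (hγeq : (L : ℝ) * γ + (S : ℝ) * γ ^ 2 = 1) (n : ℕ) :
    ((lsPoints L S γ n).ncard : ℝ) - γ * (lsPoints L S γ (n + 1)).ncard =
      (1 - γ) * (-(S * γ)) ^ n := by
  induction n with
  | zero => simp [lsPoints]
  | succ n ih =>
    rw [ncard_lsPoints_add_two hL hγ hγeq, pow_succ, ← mul_assoc, ← ih]
    push_cast
    linear_combination (-((lsPoints L S γ (n + 1)).ncard : ℝ)) * hγeq

theorem ncard_lsPoints_bounds (hL : 1 ≤ L) (hγ : 0 < γ) (hγ1 : γ < 1)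
    (hγeq : (L : ℝ) * γ + (S : ℝ) * γ ^ 2 = 1) : ∀ n,
    γ ≤ (lsPoints L S γ n).ncard * γ ^ n ∧ (lsPoints L S γ n).ncard * γ ^ n ≤ 1
  | 0 => by simp [lsPoints, hγ1.le]
  | 1 => by simp [lsPoints, hγ1.le]
  | n + 2 => by
    obtain ⟨a0, b0⟩ := ncard_lsPoints_bounds hL hγ hγ1 hγeq n
    obtain ⟨a1, b1⟩ := ncard_lsPoints_bounds hL hγ hγ1 hγeq (n + 1)
    have key : ((lsPoints L S γ (n + 2)).ncard : ℝ) * γ ^ (n + 2) =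
        L * γ * ((lsPoints L S γ (n + 1)).ncard * γ ^ (n + 1)) +
          S * γ ^ 2 * ((lsPoints L S γ n).ncard * γ ^ n) := by
      rw [ncard_lsPoints_add_two hL hγ hγeq]
      push_cast
      ring
    have hLγ : 0 ≤ L * γ := by positivity
    have hSγ : 0 ≤ S * γ ^ 2 := by positivity
    rw [key]
    constructor
    · calc γ = L * γ * γ + S * γ ^ 2 * γ := by rw [← add_mul, hγeq, one_mul]
        _ ≤ _ := by gcongr
    · calc _ ≤ L * γ * 1 + S * γ ^ 2 * 1 := by gcongr
        _ = 1 := by rw [← add_mul, hγeq, one_mul]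

theorem exists_abs_localDisc_le (hL : 1 ≤ L) (hγ : 0 < γ) (hγ1 : γ < 1)
    (hγeq : (L : ℝ) * γ + (S : ℝ) * γ ^ 2 = 1) (hq : 1 < S * γ) :
    ∃ C > (0 : ℝ), ∀ n x, 0 ≤ x → x ≤ 1 →
      |localDisc (lsPoints L S γ n) x| ≤ C * (S * γ) ^ n := by
  have hsingle : ∀ x : ℝ, 0 ≤ x → x ≤ 1 → |localDisc {0} x| ≤ 1 := by
    intro x hx0 hx1
    rcases hx0.eq_or_lt with rfl | hx
    · simp [localDisc, countBelow]
    · rw [localDisc, countBelow_of_subset (by simpa using hx), Set.ncard_singleton, abs_le]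
      constructor <;> push_cast <;> linarith
  have hq1 : 0 < S * γ - 1 := sub_pos.mpr hq
  obtain ⟨C, hC⟩ : ∃ C : ℝ, C = 1 + (L + S) * 2 * (S * γ) / (S * γ - 1) := ⟨_, rfl⟩
  have hC1 : 1 ≤ C := by
    rw [hC]
    have : 0 ≤ ((L : ℝ) + S) * 2 * (S * γ) / (S * γ - 1) := by positivity
    linarith
  have hCstep : C + (L + S) * 2 * (S * γ) ≤ C * (S * γ) := by
    have : (C - 1) * (S * γ - 1) = (L + S) * 2 * (S * γ) := by
      rw [hC]
      field_simp
      ring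
    linarith
  refine ⟨C, by linarith, fun n => ?_⟩
  induction n using Nat.strong_induction_on with
  | _ n ih =>
    match n, ih with
    | 0, _ =>
      intro x hx0 hx1
      simpa [lsPoints] using (hsingle x hx0 hx1).trans hC1
    | 1, _ =>
      intro x hx0 hx1
      rw [lsPoints, pow_one]
      exact (hsingle x hx0 hx1).trans (by nlinarith)
    | n + 2, ih =>
      intro x hx0 hx1
      have hpow : 0 < (S * γ) ^ n := by positivity
      have hdev : ∀ j < L + S,
          |((if j < L then lsPoints L S γ (n + 1) else lsPoints L S γ n).ncard : ℝ) -
            pieceLength L γ j * (lsPoints L S γ (n + 2)).ncard| ≤ 2 * (S * γ) ^ (n + 1) := by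
        intro j _
        have e0 := ncard_sub_mul_ncard hL hγ hγeq n
        have e1 := ncard_sub_mul_ncard hL hγ hγeq (n + 1)
        have hb : ∀ k, |(1 - γ) * (-(S * γ)) ^ k| ≤ (S * γ) ^ k := by
          intro k
          rw [abs_mul, abs_pow, abs_neg, abs_of_pos (zero_lt_one.trans hq),
            abs_of_pos (sub_pos.mpr hγ1)]
          exact mul_le_of_le_one_left (by positivity) (by linarith)
        unfold pieceLength
        split_ifs
        · rw [e1]
          exact (hb _).trans (by linarith [show 0 < (S * γ) ^ (n + 1) by positivity])
        · have : ((lsPoints L S γ n).ncard : ℝ) - γ ^ 2 * (lsPoints L S γ (n + 2)).ncard =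
              (1 - γ) * (-(S * γ)) ^ n + γ * ((1 - γ) * (-(S * γ)) ^ (n + 1)) := by
            rw [← e0, ← e1]
            ring
          rw [this]
          have h1 := hb n
          have h2 := hb (n + 1)
          have h3 : (S * γ) ^ n ≤ (S * γ) ^ (n + 1) := pow_le_pow_right₀ hq.le n.le_succ
          have h4 : |γ * ((1 - γ) * (-(S * γ)) ^ (n + 1))| ≤ (S * γ) ^ (n + 1) := by
            rw [abs_mul, abs_of_pos hγ]
            exact (mul_le_of_le_one_left (abs_nonneg _) hγ1.le).trans h2
          exact (abs_add_le _ _).trans (by linarith)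
      rw [lsPoints] at hdev ⊢
      have h := abs_localDisc_affineUnion_le (m := L + S) (P := fun i => bcoef L γ i * γ)
        (W := fun i => if i < L then lsPoints L S γ (n + 1) else lsPoints L S γ n)
        (M := C * (S * γ) ^ (n + 1)) (by omega)
        (pieceLength_pos (L := L) hγ) bcoef_succ_mul (by simp [bcoef_zero hL])
        (bcoef_total.trans hγeq)
        (fun j _ => by split_ifs <;> exact lsPoints_subset hL hγ hγeq _)
        (fun j _ => by split_ifs <;> exact lsPoints_finite _)
        (by positivity)
        (fun j _ y hy0 hy1 => by
          split_ifs
          · exact ih (n + 1) (by omega) y hy0 hy1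
          · refine (ih n (by omega) y hy0 hy1).trans ?_
            gcongr
            · exact hq.le
            · exact n.le_succ)
        hdev hx0 hx1
      refine h.trans ?_
      calc C * (S * γ) ^ (n + 1) + ((L + S : ℕ) : ℝ) * (2 * (S * γ) ^ (n + 1))
          ≤ (S * γ) ^ (n + 1) * (C + (L + S) * 2 * (S * γ)) := by
            push_cast
            have : ((L : ℝ) + S) * 2 * (S * γ) ^ (n + 1) * 1 ≤
                (L + S) * 2 * (S * γ) ^ (n + 1) * (S * γ) := by gcongr
            linarith
        _ ≤ (S * γ) ^ (n + 1) * (C * (S * γ)) := by gcongr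
        _ = C * (S * γ) ^ (n + 2) := by ring

theorem localDisc_lsPoints_first (hL : 1 ≤ L) (hγ : 0 < γ)
    (hγeq : (L : ℝ) * γ + (S : ℝ) * γ ^ 2 = 1) (n : ℕ) :
    localDisc (lsPoints L S γ (n + 2)) γ - localDisc (lsPoints L S γ (n + 2)) 0 =
      (1 - γ) * (-(S * γ)) ^ (n + 1) := by
  have h1 := countBelow_lsPoints hL hγ hγeq n (j := 1) (by omega)
  have hb : bcoef L γ 1 * γ = γ := by
    rw [← zero_add 1, bcoef_succ_mul, bcoef_zero hL, pieceLength, if_pos (by omega)]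
    ring
  rw [hb, min_eq_left hL, show 1 - L = 0 by omega, one_mul, zero_mul, add_zero] at h1
  rw [localDisc, localDisc, h1,
    countBelow_eq_zero fun y hy => (lsPoints_subset hL hγ hγeq _ hy).1,
    ← ncard_sub_mul_ncard hL hγ hγeq]
  push_cast
  ring

theorem one_lt_mul_of_add_two_le (hSL : L + 2 ≤ S) (hγ : 0 < γ)
    (hγeq : (L : ℝ) * γ + (S : ℝ) * γ ^ 2 = 1) : 1 < S * γ := by
  by_contra! h
  have hS : (L : ℝ) + 2 ≤ S := by exact_mod_cast hSL
  nlinarith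

end LSPartition

/-- If `S ≥ L+2` then, setting `1−τ = −log(Sγ)/log γ` (a number in
`(0,1)`), there exist constants `c, c' > 0` such that for every `n ≥ 1` (here `n+1`),
`c' · tₙ^{1−τ} ≤ tₙ · D(Λⁿ_{L,S}) ≤ c · tₙ^{1−τ}`. -/
theorem stmt_12 (L S : ℕ) (hL : 1 ≤ L) (hLS : 2 ≤ L + S) (hSL : L + 2 ≤ S)
    (γ : ℝ) (hγ0 : 0 < γ) (hγ1 : γ < 1)
    (hγeq : (L : ℝ) * γ + (S : ℝ) * γ ^ 2 = 1)
    (t : ℕ → ℕ) (ht0 : t 0 = 1) (ht1 : t 1 = L + S)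
    (htrec : ∀ n : ℕ, t (n + 2) = L * t (n + 1) + S * t n) :
    (0 < -Real.log ((S : ℝ) * γ) / Real.log γ ∧
      -Real.log ((S : ℝ) * γ) / Real.log γ < 1) ∧
    ∃ c > (0 : ℝ), ∃ c' > (0 : ℝ), ∀ n : ℕ,
      c' * (t (n + 1) : ℝ) ^ (-Real.log ((S : ℝ) * γ) / Real.log γ) ≤
        (t (n + 1) : ℝ) * discSet (lamSet L S γ (n + 1)) ∧
      (t (n + 1) : ℝ) * discSet (lamSet L S γ (n + 1)) ≤
        c * (t (n + 1) : ℝ) ^ (-Real.log ((S : ℝ) * γ) / Real.log γ) := by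
  have hq : 1 < S * γ := one_lt_mul_of_add_two_le hSL hγ0 hγeq
  have hq0 : 0 < S * γ := zero_lt_one.trans hq
  have hlogγ : Real.log γ < 0 := Real.log_neg hγ0 hγ1
  have hlogq : 0 < Real.log (S * γ) := Real.log_pos hq
  have hα0 : 0 < -Real.log ((S : ℝ) * γ) / Real.log γ :=
    div_pos_of_neg_of_neg (neg_neg_of_pos hlogq) hlogγ
  refine ⟨⟨hα0, ?_⟩, ?_⟩
  · rw [div_lt_one_of_neg hlogγ, lt_neg, ← Real.log_inv]
    refine Real.log_lt_log hq0 ?_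
    rw [lt_inv_comm₀ hq0 hγ0, lt_inv_comm₀ hγ0 hq0, inv_eq_one_div, lt_div_iff₀ hγ0]
    have : (0 : ℝ) < L * γ := mul_pos (by exact_mod_cast hL) hγ0
    nlinarith
  set α := -Real.log ((S : ℝ) * γ) / Real.log γ with hα
  have hγα : ∀ k : ℕ, ((γ ^ k)⁻¹) ^ α = (S * γ) ^ k := by
    intro k
    rw [← inv_pow, ← Real.rpow_natCast γ⁻¹, ← Real.rpow_mul (by positivity), mul_comm,
      Real.rpow_mul (by positivity), Real.rpow_natCast]
    congr 1
    rw [Real.rpow_def_of_pos (by positivity), Real.log_inv, hα, neg_mul, neg_div, mul_neg, neg_neg,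
      mul_div_cancel₀ _ hlogγ.ne, Real.exp_log hq0]
  have ht : ∀ n, t n = (lsPoints L S γ (n + 1)).ncard := by
    have h2 : ∀ n, t n = (lsPoints L S γ (n + 1)).ncard ∧
        t (n + 1) = (lsPoints L S γ (n + 2)).ncard := by
      intro n
      induction n with
      | zero =>
        refine ⟨by simp [ht0, lsPoints], ?_⟩
        rw [ht1, ncard_lsPoints_add_two hL hγ0 hγeq]
        simp [lsPoints]
      | succ n ih =>
        exact ⟨ih.2, by rw [htrec, ih.1, ih.2, ncard_lsPoints_add_two hL hγ0 hγeq (n + 1)]⟩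
    exact fun n => (h2 n).1
  have hlow : ∀ n, (S * γ) ^ n ≤ (t n : ℝ) ^ α := by
    intro n
    rw [← hγα, ht]
    refine Real.rpow_le_rpow (by positivity) ?_ hα0.le
    rw [inv_le_iff_one_le_mul₀ (by positivity)]
    have h := (ncard_lsPoints_bounds hL hγ0 hγ1 hγeq (n + 1)).1
    rw [pow_succ, ← mul_assoc] at h
    exact le_of_mul_le_mul_right (by linarith) hγ0
  have hup : ∀ n, (t n : ℝ) ^ α ≤ (S * γ) ^ (n + 1) := by
    intro n
    rw [← hγα, ht]
    refine Real.rpow_le_rpow (by positivity) ?_ hα0.le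
    rw [← one_div, le_div_iff₀ (by positivity)]
    exact (ncard_lsPoints_bounds hL hγ0 hγ1 hγeq (n + 1)).2
  obtain ⟨C, hC0, hC⟩ := exists_abs_localDisc_le hL hγ0 hγ1 hγeq hq
  refine ⟨2 * C * (S * γ), by positivity, (1 - γ) / (S * γ), div_pos (by linarith) hq0,
    fun n => ?_⟩
  have hfin := lsPoints_finite (L := L) (S := S) (γ := γ) (n + 2)
  have hne : (lsPoints L S γ (n + 2)).Nonempty := ⟨0, zero_mem_lsPoints hL _⟩
  have hl := hlow (n + 1)
  have hu := hup (n + 1)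
  rw [lamSet_eq_lsPoints hL, ht (n + 1)] at *
  constructor
  · have h := le_ncard_mul_discSet hfin hne (hC (n + 2)) le_rfl hγ0 hγ1.le
    rw [localDisc_lsPoints_first hL hγ0 hγeq, abs_mul, abs_pow, abs_neg, abs_of_pos hq0,
      abs_of_pos (sub_pos.mpr hγ1)] at h
    refine le_trans ?_ h
    rw [div_mul_eq_mul_div, div_le_iff₀ hq0, mul_assoc, ← pow_succ]
    exact mul_le_mul_of_nonneg_left hu (by linarith)
  · refine (ncard_mul_discSet_le hfin hne (hC (n + 2))).trans ?_
    calc 2 * (C * (S * γ) ^ (n + 2)) = 2 * C * (S * γ) * (S * γ) ^ (n + 1) := by ring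
      _ ≤ _ := by gcongr
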